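/- arXiv:2304.11781 — 2 statements merged into one kernel-verified Lean document; each statement's English description precedes it below -/
import Mathlib

section
/- The map from bit strings to reliability polynomials is injective: if α and γ are bit strings such that I_α = I_γ as polynomials (equivalently, I_α(x) = I_γ(x) for all real x), then α = γ. -/
/-- `relPoly α x` is the reliability polynomial `I_α(x)`:
`I_∅(x) = x`, and `I_{a₁a₂⋯aℓ}(x) = I_{a₂⋯aℓ}(I_{a₁}(x))`
with `I_0(x) = x²` and `I_1(x) = 2x − x²`.
`false` encodes the bit 0 and `true` encodes the bit 1. -/
noncomputable def relPoly : List Bool → ℝ → ℝ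
  | [], x => x
  | (b :: α), x => relPoly α (if b then 2 * x - x ^ 2 else x ^ 2)

theorem relPoly_append_singleton (α : List Bool) (b : Bool) (x : ℝ) :
    relPoly (α ++ [b]) x =
      if b then 2 * relPoly α x - relPoly α x ^ 2 else relPoly α x ^ 2 := by
  induction α generalizing x with
  | nil => simp [relPoly]
  | cons a α ih => simp only [List.cons_append, relPoly, ih]

theorem relPoly_zero (α : List Bool) : relPoly α 0 = 0 := by
  induction α with
  | nil => rfl
  | cons a α ih => cases a <;> simpa [relPoly] using ih

theorem relPoly_one (α : List Bool) : relPoly α 1 = 1 := by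
  induction α with
  | nil => rfl
  | cons a α ih =>
    cases a
    · simpa [relPoly] using ih
    · have h : (2 * 1 - 1 ^ 2 : ℝ) = 1 := by norm_num
      simpa only [relPoly, if_true, h] using ih

theorem exists_polynomial_eval_eq_relPoly (α : List Bool) :
    ∃ p : Polynomial ℝ, ∀ x, p.eval x = relPoly α x := by
  induction α with
  | nil => exact ⟨Polynomial.X, fun x => by simp [relPoly]⟩
  | cons a α ih =>
    obtain ⟨p, hp⟩ := ih
    refine ⟨p.comp (if a then 2 * Polynomial.X - Polynomial.X ^ 2 else Polynomial.X ^ 2),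
      fun x => ?_⟩
    cases a <;> simp [relPoly, hp]

/-- The set `(-∞, -2] ∪ [3, ∞)` is invariant under every reliability polynomial. -/
theorem relPoly_le_or_ge (α : List Bool) (x : ℝ) (hx : x ≤ -2 ∨ 3 ≤ x) :
    relPoly α x ≤ -2 ∨ 3 ≤ relPoly α x := by
  induction α generalizing x with
  | nil => exact hx
  | cons a α ih =>
    apply ih
    cases a
    · right
      rcases hx with hx | hx <;> simp only [Bool.false_eq_true, if_false] <;> nlinarith
    · left
      rcases hx with hx | hx <;> simp only [if_true] <;> nlinarith

theorem relPoly_three_sq_ne_two_mul_sub_sq (α γ : List Bool) :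
    relPoly α 3 ^ 2 ≠ 2 * relPoly γ 3 - relPoly γ 3 ^ 2 := by
  intro h
  rcases relPoly_le_or_ge α 3 (Or.inr le_rfl) with hα | hα <;>
    nlinarith [sq_nonneg (relPoly γ 3 - 1)]

theorem relPoly_eq_of_sq_eq (α γ : List Bool)
    (h : ∀ x, relPoly α x ^ 2 = relPoly γ x ^ 2) (x : ℝ) : relPoly α x = relPoly γ x := by
  obtain ⟨p, hp⟩ := exists_polynomial_eval_eq_relPoly α
  obtain ⟨q, hq⟩ := exists_polynomial_eval_eq_relPoly γ
  have hpq : p ^ 2 = q ^ 2 := Polynomial.funext fun y => by simpa [hp, hq] using h y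
  rcases sq_eq_sq_iff_eq_or_eq_neg.mp hpq with e | e
  · rw [← hp, ← hq, e]
  · have h1 := congrArg (Polynomial.eval 1) e
    rw [Polynomial.eval_neg, hp, hq, relPoly_one, relPoly_one] at h1
    norm_num at h1

theorem relPoly_eq_of_two_mul_sub_sq_eq (α γ : List Bool)
    (h : ∀ x, 2 * relPoly α x - relPoly α x ^ 2 = 2 * relPoly γ x - relPoly γ x ^ 2) (x : ℝ) :
    relPoly α x = relPoly γ x := by
  obtain ⟨p, hp⟩ := exists_polynomial_eval_eq_relPoly α
  obtain ⟨q, hq⟩ := exists_polynomial_eval_eq_relPoly γ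
  have hpq : (1 - p) ^ 2 = (1 - q) ^ 2 := Polynomial.funext fun y => by
    simp only [Polynomial.eval_pow, Polynomial.eval_sub, Polynomial.eval_one, hp, hq]
    linear_combination -h y
  rcases sq_eq_sq_iff_eq_or_eq_neg.mp hpq with e | e
  · rw [← hp, ← hq, sub_right_injective e]
  · have h0 := congrArg (Polynomial.eval 0) e
    simp only [Polynomial.eval_neg, Polynomial.eval_sub, Polynomial.eval_one, hp, hq,
      relPoly_zero] at h0
    norm_num at h0

theorem not_forall_relPoly_append_singleton_eq_self (α : List Bool) (b : Bool) :
    ¬ ∀ x, relPoly (α ++ [b]) x = x := by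
  intro h
  cases b
  · have h1 := h (-1)
    simp only [relPoly_append_singleton, Bool.false_eq_true, if_false] at h1
    nlinarith [sq_nonneg (relPoly α (-1))]
  · have h2 := h 2
    simp only [relPoly_append_singleton, if_true] at h2
    nlinarith [sq_nonneg (relPoly α 2 - 1)]

/-- The map from bit strings to reliability polynomials is injective. -/
theorem relPoly_injective (α γ : List Bool)
    (h : ∀ x : ℝ, relPoly α x = relPoly γ x) : α = γ := by
  induction α using List.reverseRecOn generalizing γ with
  | nil =>
    rcases List.eq_nil_or_concat' γ with rfl | ⟨γ, c, rfl⟩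
    · rfl
    · exact absurd (fun x => (h x).symm) (not_forall_relPoly_append_singleton_eq_self γ c)
  | append_singleton α b ih =>
    rcases List.eq_nil_or_concat' γ with rfl | ⟨γ, c, rfl⟩
    · exact absurd h (not_forall_relPoly_append_singleton_eq_self α b)
    · simp only [relPoly_append_singleton] at h
      cases b <;> cases c <;> simp only [Bool.false_eq_true, if_false, if_true] at h
      · rw [ih γ (relPoly_eq_of_sq_eq α γ h)]
      · exact absurd (h 3) (relPoly_three_sq_ne_two_mul_sub_sq α γ)
      · exact absurd (h 3).symm (relPoly_three_sq_ne_two_mul_sub_sq γ α)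
      · rw [ih γ (relPoly_eq_of_two_mul_sub_sq_eq α γ h)]
end

section
/- For every integer k ≥ 1, the length-4k prefix τ_1 τ_2 ⋯ τ_{4k} of the Thue–Morse word is outperformed by its bitwise complement: I_{τ_1 ⋯ τ_{4k}}(x) ≤ I_{complement of τ_1 ⋯ τ_{4k}}(x) for all x ∈ [0,1]. -/
/-- `α ≽ γ` : `I_α(x) ≥ I_γ(x)` for all `x ∈ [0,1]`. -/
def outperforms (α γ : List Bool) : Prop :=
  ∀ x ∈ Set.Icc (0 : ℝ) 1, relPoly γ x ≤ relPoly α x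

/-- The Thue-Morse word: tau (n+1) is the parity of the number of 1's
in the binary representation of n; here `thueMorse i` gives the (i+1)-st
letter of the word, i.e. the parity of the popcount of i. -/
def thueMorse (i : ℕ) : Bool := decide ((Nat.digits 2 i).count 1 % 2 = 1)

/-- The reliability polynomial in homogeneous coordinates `(x, y)`, where `y` stands for `1 - x`. -/
def relPair : List Bool → ℝ → ℝ → ℝ × ℝ
  | [], x, y => (x, y)
  | (true :: α), x, y => relPair α (x ^ 2 + 2 * x * y) (y ^ 2)
  | (false :: α), x, y => relPair α (x ^ 2) (y ^ 2 + 2 * x * y)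

theorem relPair_eq (α : List Bool) (x : ℝ) :
    relPair α x (1 - x) = (relPoly α x, 1 - relPoly α x) := by
  induction α generalizing x with
  | nil => rfl
  | cons b α ih =>
    cases b
    · simp only [relPair, relPoly, Bool.false_eq_true, if_false]
      rw [← ih]
      ring_nf
    · simp only [relPair, relPoly, if_true]
      rw [← ih]
      ring_nf

theorem relPair_smul (α : List Bool) (t x y : ℝ) :
    relPair α (t * x) (t * y) = t ^ 2 ^ α.length • relPair α x y := by
  induction α generalizing t x y with
  | nil => simp [relPair]
  | cons b α ih =>
    rw [List.length_cons, pow_succ' 2, pow_mul]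
    cases b <;> simp only [relPair] <;> rw [← ih] <;> congr 1 <;> ring

/-- The word `0110` for the bit `0` and its complement `1001` for the bit `1`. -/
def thueMorseBlock (b : Bool) : List Bool := [b, !b, !b, b]

/-- The odds of `z` are at least `14 / 11` times the odds of `x`. -/
def OddsGap (x z : ℝ) : Prop := 14 * x * (1 - z) ≤ 11 * z * (1 - x)

theorem OddsGap.le {x z : ℝ} (h : OddsGap x z) (hx : 0 ≤ x) (hz : z ≤ 1) : x ≤ z := by
  unfold OddsGap at h
  nlinarith [mul_nonneg hx (sub_nonneg.2 hz)]

theorem OddsGap.mono {x x' z z' : ℝ} (h : OddsGap x z) (hx' : 0 ≤ x') (hxx : x' ≤ x)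
    (hx : x ≤ 1) (hz : 0 ≤ z) (hzz : z ≤ z') (hz' : z' ≤ 1) : OddsGap x' z' := by
  unfold OddsGap at h ⊢
  have h₁ := mul_le_mul hxx (sub_le_sub_left hzz 1) (sub_nonneg.2 hz') (hx'.trans hxx)
  have h₂ := mul_le_mul hzz (sub_le_sub_left hxx 1) (sub_nonneg.2 hx) (hz.trans hzz)
  linarith

theorem relPair_block_gap {x y : ℝ} (hx : 0 ≤ x) (hy : 0 ≤ y) :
    14 * (relPair (thueMorseBlock false) x y).1 * (relPair (thueMorseBlock true) x y).2 ≤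
      11 * (relPair (thueMorseBlock true) x y).1 * (relPair (thueMorseBlock false) x y).2 := by
  have h : 0 ≤
      128 * x ^ 4 * y ^ 28 + 2880 * x ^ 5 * y ^ 27 + 30576 * x ^ 6 * y ^ 26 +
        203248 * x ^ 7 * y ^ 25 + 944990 * x ^ 8 * y ^ 24 + 3246992 * x ^ 9 * y ^ 23 +
        8481224 * x ^ 10 * y ^ 22 + 17036272 * x ^ 11 * y ^ 21 + 26275492 * x ^ 12 * y ^ 20 +
        30701008 * x ^ 13 * y ^ 19 + 26668616 * x ^ 14 * y ^ 18 + 17831696 * x ^ 15 * y ^ 17 +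
        13242137 * x ^ 16 * y ^ 16 + 17831696 * x ^ 17 * y ^ 15 + 26668616 * x ^ 18 * y ^ 14 +
        30701008 * x ^ 19 * y ^ 13 + 26275492 * x ^ 20 * y ^ 12 + 17036272 * x ^ 21 * y ^ 11 +
        8481224 * x ^ 22 * y ^ 10 + 3246992 * x ^ 23 * y ^ 9 + 944990 * x ^ 24 * y ^ 8 +
        203248 * x ^ 25 * y ^ 7 + 30576 * x ^ 26 * y ^ 6 + 2880 * x ^ 27 * y ^ 5 +
        128 * x ^ 28 * y ^ 4 := by
    positivity
  rw [← sub_nonneg]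
  refine h.trans_eq ?_
  simp only [thueMorseBlock, relPair, Bool.not_false, Bool.not_true]
  ring

theorem relPair_block_gap_scaled {x y : ℝ} (hx : 0 ≤ x) (hy : 0 ≤ y) :
    14 * (relPair (thueMorseBlock true) x y).1 *
        (relPair (thueMorseBlock false) (14 * x) (11 * y)).2 ≤
      11 * (relPair (thueMorseBlock false) (14 * x) (11 * y)).1 *
        (relPair (thueMorseBlock true) x y).2 := by
  have h : 0 ≤
      634113176659724608 * x ^ 4 * y ^ 28 + 38544520232704413312 * x ^ 5 * y ^ 27 +
        767098188007902207072 * x ^ 6 * y ^ 26 + 8315431882380030257696 * x ^ 7 * y ^ 25 +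
        58666052318737098099172 * x ^ 8 * y ^ 24 + 294275859240864569585440 * x ^ 9 * y ^ 23 +
        1105579548033095189694640 * x ^ 10 * y ^ 22 +
        3220553688950895768015776 * x ^ 11 * y ^ 21 +
        7468702319609557622785112 * x ^ 12 * y ^ 20 +
        14124031210832595810968672 * x ^ 13 * y ^ 19 +
        22341776821716963568194160 * x ^ 14 * y ^ 18 +
        30379337945735527743192352 * x ^ 15 * y ^ 17 +
        36355788277984033898551666 * x ^ 16 * y ^ 16 +
        38664611930936126218608448 * x ^ 17 * y ^ 15 +
        36189985595508469912116160 * x ^ 18 * y ^ 14 +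
        29118213104826929305257728 * x ^ 19 * y ^ 13 +
        19596862803778482729110912 * x ^ 20 * y ^ 12 +
        10754922771086963542836224 * x ^ 21 * y ^ 11 +
        4698963799597597498608640 * x ^ 22 * y ^ 10 + 1591849810585144158146560 * x ^ 23 * y ^ 9 +
        403896109024359168566272 * x ^ 24 * y ^ 8 + 72862314887976448507904 * x ^ 25 * y ^ 7 +
        8554693656685785219072 * x ^ 26 * y ^ 6 + 547080833677440319488 * x ^ 27 * y ^ 5 +
        11454891607603806208 * x ^ 28 * y ^ 4 := by
    positivity
  rw [← sub_nonneg]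
  refine h.trans_eq ?_
  simp only [thueMorseBlock, relPair, Bool.not_false, Bool.not_true]
  ring

theorem relPoly_append (α β : List Bool) (x : ℝ) :
    relPoly (α ++ β) x = relPoly β (relPoly α x) := by
  induction α generalizing x with
  | nil => rfl
  | cons b α ih => exact ih _

theorem relPoly_step_mem (b : Bool) {x : ℝ} (hx : x ∈ Set.Icc (0 : ℝ) 1) :
    (if b then 2 * x - x ^ 2 else x ^ 2) ∈ Set.Icc (0 : ℝ) 1 := by
  obtain ⟨h0, h1⟩ := hx
  cases b
  · simp only [Bool.false_eq_true, if_false]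
    constructor <;> nlinarith
  · simp only [if_true]
    constructor <;> nlinarith

theorem relPoly_mem (α : List Bool) {x : ℝ} (hx : x ∈ Set.Icc (0 : ℝ) 1) :
    relPoly α x ∈ Set.Icc (0 : ℝ) 1 := by
  induction α generalizing x with
  | nil => exact hx
  | cons b α ih => exact ih (relPoly_step_mem b hx)

theorem relPoly_mono (α : List Bool) {x z : ℝ} (hx : x ∈ Set.Icc (0 : ℝ) 1)
    (hz : z ∈ Set.Icc (0 : ℝ) 1) (h : x ≤ z) : relPoly α x ≤ relPoly α z := by
  induction α generalizing x z with
  | nil => exact h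
  | cons b α ih =>
    refine ih (relPoly_step_mem b hx) (relPoly_step_mem b hz) ?_
    obtain ⟨hx0, hx1⟩ := hx
    obtain ⟨hz0, hz1⟩ := hz
    cases b
    · simp only [Bool.false_eq_true, if_false]
      nlinarith
    · simp only [if_true]
      nlinarith

theorem oddsGap_block_self {x : ℝ} (hx : x ∈ Set.Icc (0 : ℝ) 1) :
    OddsGap (relPoly (thueMorseBlock false) x) (relPoly (thueMorseBlock true) x) := by
  simpa only [OddsGap, relPair_eq] using relPair_block_gap hx.1 (sub_nonneg.2 hx.2)

theorem relPoly_block_false_le_true {x : ℝ} (hx : x ∈ Set.Icc (0 : ℝ) 1) :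
    relPoly (thueMorseBlock false) x ≤ relPoly (thueMorseBlock true) x :=
  (oddsGap_block_self hx).le (relPoly_mem _ hx).1 (relPoly_mem _ hx).2

theorem oddsGap_block_true_false {x z : ℝ} (hx : x ∈ Set.Icc (0 : ℝ) 1)
    (hz : z ∈ Set.Icc (0 : ℝ) 1) (h : OddsGap x z) :
    OddsGap (relPoly (thueMorseBlock true) x) (relPoly (thueMorseBlock false) z) := by
  have hx0 : 0 ≤ x := hx.1
  have hs : 0 < 11 + 3 * x := by positivity
  set t : ℝ := (11 + 3 * x)⁻¹ with ht
  have ht0 : 0 < t := inv_pos.2 hs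
  have hts : t * (11 + 3 * x) = 1 := inv_mul_cancel₀ hs.ne'
  have hw : 1 - t * (14 * x) = t * (11 * (1 - x)) := by linear_combination -hts
  have hw0 : 0 ≤ t * (11 * (1 - x)) := by
    have := sub_nonneg.2 hx.2
    positivity
  have hmem : t * (14 * x) ∈ Set.Icc (0 : ℝ) 1 := ⟨by positivity, by linarith⟩
  have hle : t * (14 * x) ≤ z := by
    have hzs : 14 * x ≤ z * (11 + 3 * x) := by
      unfold OddsGap at h
      linarith
    calc t * (14 * x) ≤ t * (z * (11 + 3 * x)) := mul_le_mul_of_nonneg_left hzs ht0.le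
      _ = z := by linear_combination z * hts
  have hpair := relPair_eq (thueMorseBlock false) (t * (14 * x))
  rw [hw, relPair_smul] at hpair
  have h₁ := congrArg Prod.fst hpair
  have h₂ := congrArg Prod.snd hpair
  simp only [Prod.smul_fst, Prod.smul_snd, smul_eq_mul] at h₁ h₂
  have hgap : OddsGap (relPoly (thueMorseBlock true) x)
      (relPoly (thueMorseBlock false) (t * (14 * x))) := by
    have key := relPair_block_gap_scaled hx0 (sub_nonneg.2 hx.2)
    rw [relPair_eq] at key
    unfold OddsGap
    rw [← h₂, ← h₁]
    have := mul_le_mul_of_nonneg_left key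
      (pow_nonneg ht0.le (2 ^ (thueMorseBlock false).length))
    linarith
  exact hgap.mono (relPoly_mem _ hx).1 le_rfl (relPoly_mem _ hx).2 (relPoly_mem _ hmem).1
    (relPoly_mono _ hmem hz hle) (relPoly_mem _ hz).2

theorem oddsGap_block (b c : Bool) {x z : ℝ} (hx : x ∈ Set.Icc (0 : ℝ) 1)
    (hz : z ∈ Set.Icc (0 : ℝ) 1) (h : OddsGap x z) :
    OddsGap (relPoly (thueMorseBlock b) x) (relPoly (thueMorseBlock c) z) := by
  refine (oddsGap_block_true_false hx hz h).mono (relPoly_mem _ hx).1 ?_ (relPoly_mem _ hx).2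
    (relPoly_mem _ hz).1 ?_ (relPoly_mem _ hz).2
  · cases b
    · exact relPoly_block_false_le_true hx
    · exact le_rfl
  · cases c
    · exact le_rfl
    · exact relPoly_block_false_le_true hz

theorem relPoly_flatMap_block_le {α γ : List Bool} (hl : α.length = γ.length) {x z : ℝ}
    (hx : x ∈ Set.Icc (0 : ℝ) 1) (hz : z ∈ Set.Icc (0 : ℝ) 1) (h : OddsGap x z) :
    relPoly (α.flatMap thueMorseBlock) x ≤ relPoly (γ.flatMap thueMorseBlock) z := by
  induction α generalizing γ x z with
  | nil =>
    obtain rfl := List.length_eq_zero_iff.1 hl.symm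
    exact h.le hx.1 hz.2
  | cons b α ih =>
    cases γ with
    | nil => simp at hl
    | cons c γ =>
      simp only [List.flatMap_cons, relPoly_append]
      exact ih (by simpa using hl) (relPoly_mem _ hx) (relPoly_mem _ hz)
        (oddsGap_block b c hx hz h)

/-- Concatenations of the blocks `0110` and `1001` are ordered lexicographically. -/
theorem outperforms_flatMap_block {α γ : List Bool} (hl : α.length = γ.length) :
    outperforms ((true :: α).flatMap thueMorseBlock) ((false :: γ).flatMap thueMorseBlock) := by
  intro x hx
  simp only [List.flatMap_cons, relPoly_append]
  exact relPoly_flatMap_block_le hl.symm (relPoly_mem _ hx) (relPoly_mem _ hx)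
    (oddsGap_block_self hx)

theorem thueMorse_zero : thueMorse 0 = false := by
  simp [thueMorse]

theorem thueMorse_two_mul (n : ℕ) : thueMorse (2 * n) = thueMorse n := by
  rcases Nat.eq_zero_or_pos n with rfl | hn
  · rfl
  · simp [thueMorse, Nat.digits_def' (b := 2) (n := 2 * n) (by norm_num) (by omega)]

theorem thueMorse_two_mul_add_one (n : ℕ) : thueMorse (2 * n + 1) = !thueMorse n := by
  have h : Nat.digits 2 (2 * n + 1) = 1 :: Nat.digits 2 n := by
    rw [Nat.digits_def' (by norm_num) (by omega)]
    congr 2 <;> omega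
  unfold thueMorse
  rw [h, List.count_cons_self, ← decide_not, decide_eq_decide]
  omega

theorem map_thueMorse_range_four_mul (k : ℕ) :
    (List.range (4 * k)).map thueMorse =
      ((List.range k).map thueMorse).flatMap thueMorseBlock := by
  induction k with
  | zero => rfl
  | succ k ih =>
    have h₀ : thueMorse (4 * k) = thueMorse k := by
      rw [show 4 * k = 2 * (2 * k) by ring, thueMorse_two_mul, thueMorse_two_mul]
    have h₁ : thueMorse (4 * k + 1) = !thueMorse k := by
      rw [show 4 * k + 1 = 2 * (2 * k) + 1 by ring, thueMorse_two_mul_add_one, thueMorse_two_mul]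
    have h₂ : thueMorse (4 * k + 2) = !thueMorse k := by
      rw [show 4 * k + 2 = 2 * (2 * k + 1) by ring, thueMorse_two_mul, thueMorse_two_mul_add_one]
    have h₃ : thueMorse (4 * k + 3) = thueMorse k := by
      rw [show 4 * k + 3 = 2 * (2 * k + 1) + 1 by ring, thueMorse_two_mul_add_one,
        thueMorse_two_mul_add_one, Bool.not_not]
    rw [show 4 * (k + 1) = 4 * k + 1 + 1 + 1 + 1 by ring]
    simp [List.range_succ, ih, h₀, h₁, h₂, h₃, thueMorseBlock]

theorem map_not_flatMap_block (α : List Bool) :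
    (α.flatMap thueMorseBlock).map (fun b => !b) =
      (α.map (fun b => !b)).flatMap thueMorseBlock := by
  induction α with
  | nil => rfl
  | cons b α ih => simp [thueMorseBlock, ih]

/-- For every k ≥ 1, the length-4k prefix of the Thue-Morse word is
outperformed by its bitwise complement. -/
theorem thueMorse_prefix_outperformed (k : ℕ) (hk : 1 ≤ k) :
    outperforms (((List.range (4 * k)).map thueMorse).map (fun b => !b))
      ((List.range (4 * k)).map thueMorse) := by
  obtain ⟨k, rfl⟩ := Nat.exists_eq_add_of_le' hk
  rw [map_thueMorse_range_four_mul, map_not_flatMap_block, List.range_succ_eq_map,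
    List.map_cons, List.map_cons, thueMorse_zero]
  exact outperforms_flatMap_block (by simp)
end
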